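/- For every sequence of revealing probabilities {p_t}_{t=1}^∞ ⊆ [0,1], limsup_{t→∞} t·E_t ≥ κ*(a,b). -/

import Mathlib

open MeasureTheory ProbabilityTheory Filter Asymptotics
open scoped ENNReal NNReal

noncomputable section

/-- The constant `κ*(a,b)` from the paper. -/
def kappaStar (a b : ℝ) : ℝ :=
  1 / (1 + (a / b - 1) / Real.log (a / b) *
      (Real.log ((a / b - 1) / Real.log (a / b)) - 1))

/-- The signal distribution: `signalProb a b i x = P(X_t = x | θ = i)`,
equal to `a/(a+b)` if `x = i` and `b/(a+b)` otherwise. -/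
def signalProb (a b : ℝ) (i x : ℕ) : ℝ :=
  if x = i then a / (a + b) else b / (a + b)

/-- The D-likelihood `D_i^t = Q_i^t(Z_1,…,Z_{t-1},X_t)`: the conditional probability, given
`θ = i`, of observing the actions `Z_1,…,Z_{t-1}` and private signal `X_t` that actually
occurred at the sample point `ω`. -/
def Dlike {Ω : Type*} [MeasurableSpace Ω] (μ : Measure Ω) (θ : Ω → ℕ)
    (X Z : ℕ → Ω → ℕ) (t : ℕ) (i : ℕ) (ω : Ω) : ℝ :=
  (μ {ω' | θ ω' = i ∧ (∀ s ∈ Finset.Icc 1 (t - 1), Z s ω' = Z s ω) ∧ X t ω' = X t ω}).toReal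
    / (μ {ω' | θ ω' = i}).toReal

/-- The maximum a posteriori estimate of `θ` given `(Z_1,…,Z_{t-1},X_t)`, with ties broken
by following the private signal `X_t`.  (The prior on `θ` is uniform, so comparing the
posteriors amounts to comparing `D_1^t` and `D_2^t`.) -/
def mapEst {Ω : Type*} [MeasurableSpace Ω] (μ : Measure Ω) (θ : Ω → ℕ)
    (X Z : ℕ → Ω → ℕ) (t : ℕ) (ω : Ω) : ℕ :=
  if Dlike μ θ X Z t 2 ω < Dlike μ θ X Z t 1 ω then 1
  else if Dlike μ θ X Z t 1 ω < Dlike μ θ X Z t 2 ω then 2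
  else X t ω

/-- The L-likelihood `L_i^t = P_i(Z_1 = z_1, …, Z_t = z_t)` evaluated at the observed
actions. -/
def Llike {Ω : Type*} [MeasurableSpace Ω] (μ : Measure Ω) (θ : Ω → ℕ)
    (Z : ℕ → Ω → ℕ) (t : ℕ) (i : ℕ) (ω : Ω) : ℝ :=
  (μ {ω' | θ ω' = i ∧ ∀ s ∈ Finset.Icc 1 t, Z s ω' = Z s ω}).toReal
    / (μ {ω' | θ ω' = i}).toReal

/-- The likelihood ratio `R_t = L_1^t / L_2^t` (with `R_0 = 1`). -/
def LR {Ω : Type*} [MeasurableSpace Ω] (μ : Measure Ω) (θ : Ω → ℕ)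
    (Z : ℕ → Ω → ℕ) (t : ℕ) (ω : Ω) : ℝ :=
  Llike μ θ Z t 1 ω / Llike μ θ Z t 2 ω

/-- The sequential decision making model with Bayesians and revealers.
`θ` is the state of the world, uniform on `{1,2}`; given `θ`, the signals `X_t` are i.i.d.
with `P(X_t = θ | θ) = a/(a+b)`, the revealing indicators `I_t` are independent Bernoulli
with `E[I_t] = p_t`, independent of everything else (this is the content of `joint`), and
the actions are `Z_t = X_t` if `I_t = 1` and `Z_t = MAP(Z_1,…,Z_{t-1},X_t)` if `I_t = 0`
(field `dynamics`).  Players are indexed by `t ≥ 1`; `Z 0` is set to the constant `1` for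
definiteness. -/
structure IsCascade (a b : ℝ) (p : ℕ → ℝ) {Ω : Type*} [MeasurableSpace Ω]
    (μ : Measure Ω) (θ : Ω → ℕ) (X I Z : ℕ → Ω → ℕ) : Prop where
  prob : IsProbabilityMeasure μ
  theta_meas : Measurable θ
  X_meas : ∀ t, Measurable (X t)
  I_meas : ∀ t, Measurable (I t)
  Z_meas : ∀ t, Measurable (Z t)
  p_mem : ∀ t : ℕ, 1 ≤ t → p t ∈ Set.Icc (0 : ℝ) 1
  theta_range : ∀ ω, θ ω = 1 ∨ θ ω = 2
  X_range : ∀ t ω, X t ω = 1 ∨ X t ω = 2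
  I_range : ∀ t ω, I t ω = 0 ∨ I t ω = 1
  Z_zero : ∀ ω, Z 0 ω = 1
  joint : ∀ i : ℕ, i = 1 ∨ i = 2 → ∀ s : Finset ℕ, (∀ t ∈ s, 1 ≤ t) →
    ∀ x c : ℕ → ℕ, (∀ t, x t = 1 ∨ x t = 2) → (∀ t, c t = 0 ∨ c t = 1) →
    (μ {ω | θ ω = i ∧ ∀ t ∈ s, X t ω = x t ∧ I t ω = c t}).toReal
      = 1 / 2 * ∏ t ∈ s, signalProb a b i (x t) * (if c t = 1 then p t else 1 - p t)
  dynamics : ∀ t : ℕ, 1 ≤ t → ∀ ω,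
    Z t ω = if I t ω = 1 then X t ω else mapEst μ θ X Z t ω

/-- The error probability `E_t = P(Z_t ≠ θ)`. -/
def errProb {Ω : Type*} [MeasurableSpace Ω] (μ : Measure Ω) (θ : Ω → ℕ)
    (Z : ℕ → Ω → ℕ) (t : ℕ) : ℝ :=
  (μ {ω | Z t ω ≠ θ ω}).toReal

/-- The probability that the MAP estimator is wrong at time `t`:
`P(MAP(Z_1,…,Z_{t-1},X_t) ≠ θ)`. -/
def mapErr {Ω : Type*} [MeasurableSpace Ω] (μ : Measure Ω) (θ : Ω → ℕ)
    (X Z : ℕ → Ω → ℕ) (t : ℕ) : ℝ :=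
  (μ {ω | mapEst μ θ X Z t ω ≠ θ ω}).toReal

/-- One-step moment of the likelihood ratio in the cascade regime. -/
def mm (α β k s p : ℝ) : ℝ :=
  p * α * k ^ (-s) + (1 - p * α) * ((1 - p * β) / (1 - p * α)) ^ s

/-- Probability of staying in the wrong cascade for `n` further steps. -/
def Phi (α β k : ℝ) (p : ℕ → ℝ) : ℕ → ℕ → ℝ → ℝ
  | 0, _, r => if k < r then 1 else 0
  | n + 1, T, r => if k < r then
      p (T + 1) * α * Phi α β k p n (T + 1) (r / k) +
      (1 - p (T + 1) * α) *
        Phi α β k p n (T + 1) (r * ((1 - p (T + 1) * β) / (1 - p (T + 1) * α)))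
    else 0

/-- Product of one-step moments. -/
def MM (α β k : ℝ) (p : ℕ → ℝ) (s : ℝ) (n T : ℕ) : ℝ :=
  ∏ j ∈ Finset.Ioc T (T + n), mm α β k s (p j)

/-- The rate function. -/
def Lam (α β k s : ℝ) : ℝ := α - (α - β) * s - α * k ^ (-s)

theorem MM_succ (α β k : ℝ) (p : ℕ → ℝ) (s : ℝ) (n T : ℕ) :
    MM α β k p s (n + 1) T = mm α β k s (p (T + 1)) * MM α β k p s n (T + 1) := by
  unfold MM
  have h : Finset.Ioc T (T + (n + 1)) = insert (T + 1) (Finset.Ioc (T + 1) (T + 1 + n)) := by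
    ext x; simp only [Finset.mem_Ioc, Finset.mem_insert]; omega
  rw [h, Finset.prod_insert (by simp)]

theorem mm_pos {α β k s p : ℝ} (hα : 0 < α) (hα1 : α < 1) (hβα : β < α)
    (hk : 0 < k) (hp : p ∈ Set.Icc (0 : ℝ) 1) : 0 < mm α β k s p := by
  obtain ⟨h0, h1⟩ := hp
  have e1 : 0 < 1 - p * α := by nlinarith
  have e2 : 0 < 1 - p * β := by nlinarith
  unfold mm
  have := Real.rpow_pos_of_pos hk (-s)
  have := Real.rpow_pos_of_pos (div_pos e2 e1) s
  positivity

theorem MM_pos {α β k s : ℝ} {p : ℕ → ℝ} (hα : 0 < α) (hα1 : α < 1) (hβα : β < α)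
    (hk : 0 < k) {n T : ℕ} (hp : ∀ t, 1 ≤ t → p t ∈ Set.Icc (0 : ℝ) 1) :
    0 < MM α β k p s n T :=
  Finset.prod_pos fun j hj => mm_pos hα hα1 hβα hk (hp j (by
    have := (Finset.mem_Ioc.1 hj).1; omega))

theorem Phi_lower {α β k : ℝ} {p : ℕ → ℝ} {s δ K : ℝ} (hα : 0 < α) (hα1 : α < 1)
    (hβα : β < α) (hk : 0 < k) (hs : 0 ≤ s) (hδ : 0 ≤ δ) (hK : 0 < K) (T0 : ℕ)
    (hp : ∀ t, 1 ≤ t → p t ∈ Set.Icc (0 : ℝ) 1)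
    (hmono : ∀ t, T0 < t → mm α β k (s - δ) (p t) ≤ mm α β k s (p t)) (n : ℕ) :
    ∀ T r, T0 ≤ T → 0 < r →
      K ^ (-s) * (MM α β k p s n T * (r ^ s - k ^ δ * r ^ (s - δ))
        - K ^ (-δ) * (MM α β k p (s + δ) n T * r ^ (s + δ))) ≤ Phi α β k p n T r := by
  have bad : ∀ n T r, 0 < r → ¬ k < r →
      K ^ (-s) * (MM α β k p s n T * (r ^ s - k ^ δ * r ^ (s - δ))
        - K ^ (-δ) * (MM α β k p (s + δ) n T * r ^ (s + δ))) ≤ 0 := by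
    intro n T r hr hkr
    have h1 : r ^ s ≤ k ^ δ * r ^ (s - δ) := by
      have : r ^ s = r ^ δ * r ^ (s - δ) := by
        rw [← Real.rpow_add hr]; congr 1; ring
      rw [this]
      have := Real.rpow_le_rpow hr.le (not_lt.1 hkr) hδ
      have := Real.rpow_pos_of_pos hr (s - δ)
      gcongr
    have m1 : 0 < MM α β k p s n T := MM_pos hα hα1 hβα hk hp
    have m2 : 0 < MM α β k p (s + δ) n T := MM_pos hα hα1 hβα hk hp
    have h2 : 0 ≤ K ^ (-δ) * (MM α β k p (s + δ) n T * r ^ (s + δ)) := by positivity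
    have h3 : MM α β k p s n T * (r ^ s - k ^ δ * r ^ (s - δ)) ≤ 0 :=
      mul_nonpos_of_nonneg_of_nonpos m1.le (by linarith)
    exact mul_nonpos_of_nonneg_of_nonpos (by positivity) (by linarith)
  induction n with
  | zero =>
    intro T r hT hr
    by_cases hkr : k < r
    · simp only [Phi, hkr, if_true, MM, add_zero, Finset.Ioc_self, Finset.prod_empty, one_mul]
      have hw : 0 < r / K := by positivity
      have e1 : K ^ (-s) * r ^ s = (r / K) ^ s := by
        rw [Real.div_rpow hr.le hK.le, Real.rpow_neg hK.le]; field_simp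
      have e2 : K ^ (-s) * (K ^ (-δ) * r ^ (s + δ)) = (r / K) ^ (s + δ) := by
        rw [Real.div_rpow hr.le hK.le, ← mul_assoc, ← Real.rpow_add hK,
          show -s + -δ = -(s + δ) by ring, Real.rpow_neg hK.le]; field_simp
      have e3 : 0 ≤ K ^ (-s) * (k ^ δ * r ^ (s - δ)) := by positivity
      have e4 : (r / K) ^ s - (r / K) ^ (s + δ) ≤ 1 := by
        rcases le_total (r / K) 1 with h | h
        · have := Real.rpow_le_one hw.le h hs
          have := Real.rpow_pos_of_pos hw (s + δ)
          linarith
        · have := Real.rpow_le_rpow_of_exponent_le h (by linarith : s ≤ s + δ)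
          linarith
      nlinarith
    · simp only [Phi, hkr, if_false]
      exact bad 0 T r hr hkr
  | succ n ih =>
    intro T r hT hr
    by_cases hkr : k < r
    · simp only [Phi, hkr, if_true]
      have hpT := hp (T + 1) (by omega)
      have hm := hmono (T + 1) (by omega)
      have m1 : 0 < MM α β k p s n (T + 1) := MM_pos hα hα1 hβα hk hp
      have e1 : 0 < 1 - p (T + 1) * α := by nlinarith [hpT.1, hpT.2]
      have e2 : 0 < 1 - p (T + 1) * β := by nlinarith [hpT.1, hpT.2]
      rw [MM_succ, MM_succ]
      set q := p (T + 1) with hq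
      set x := (1 - q * β) / (1 - q * α) with hx
      have hx0 : 0 < x := div_pos e2 e1
      have i1 := ih (T + 1) (r / k) (by omega) (by positivity)
      have i2 := ih (T + 1) (r * x) (by omega) (by positivity)
      have hqα : 0 ≤ q * α := mul_nonneg hpT.1 hα.le
      have key : ∀ σ : ℝ, q * α * (r / k) ^ σ + (1 - q * α) * (r * x) ^ σ
          = mm α β k σ q * r ^ σ := by
        intro σ
        unfold mm
        rw [Real.div_rpow hr.le hk.le, Real.mul_rpow hr.le hx0.le, Real.rpow_neg hk.le, ← hx]
        field_simp
      have k1 := key s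
      have k2 := key (s - δ)
      have k3 := key (s + δ)
      refine le_trans ?_ (add_le_add (mul_le_mul_of_nonneg_left i1 hqα)
        (mul_le_mul_of_nonneg_left i2 e1.le))
      have hK' : 0 < K ^ (-s) := by positivity
      have : q * α * (K ^ (-s) * (MM α β k p s n (T + 1) * ((r / k) ^ s - k ^ δ * (r / k) ^ (s - δ)) -
            K ^ (-δ) * (MM α β k p (s + δ) n (T + 1) * (r / k) ^ (s + δ)))) +
        (1 - q * α) * (K ^ (-s) * (MM α β k p s n (T + 1) * ((r * x) ^ s - k ^ δ * (r * x) ^ (s - δ)) -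
            K ^ (-δ) * (MM α β k p (s + δ) n (T + 1) * (r * x) ^ (s + δ))))
        = K ^ (-s) * (MM α β k p s n (T + 1) * (mm α β k s q * r ^ s
            - k ^ δ * (mm α β k (s - δ) q * r ^ (s - δ))) -
            K ^ (-δ) * (MM α β k p (s + δ) n (T + 1) * (mm α β k (s + δ) q * r ^ (s + δ)))) := by
        rw [← k1, ← k2, ← k3]; ring
      rw [this]
      have h5 : k ^ δ * (mm α β k (s - δ) q * r ^ (s - δ))
          ≤ k ^ δ * (mm α β k s q * r ^ (s - δ)) := by gcongr
      have h6 := mul_le_mul_of_nonneg_left h5 m1.le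
      refine mul_le_mul_of_nonneg_left ?_ hK'.le
      nlinarith
    · simp only [Phi, hkr, if_false]
      exact bad (n + 1) T r hr hkr

theorem mm_zero (α β k s : ℝ) : mm α β k s 0 = 1 := by simp [mm]

theorem mm_hasDeriv (α β k s : ℝ) :
    HasDerivAt (fun p => Real.log (mm α β k s p)) (-Lam α β k s) 0 := by
  have h1 : HasDerivAt (fun p : ℝ => p * α * k ^ (-s)) (α * k ^ (-s)) 0 := by
    simpa using ((hasDerivAt_id (0 : ℝ)).mul_const α).mul_const (k ^ (-s))
  have h2 : HasDerivAt (fun p : ℝ => 1 - p * α) (-α) 0 := by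
    simpa using ((hasDerivAt_id (0 : ℝ)).mul_const α).const_sub 1
  have h3 : HasDerivAt (fun p : ℝ => 1 - p * β) (-β) 0 := by
    simpa using ((hasDerivAt_id (0 : ℝ)).mul_const β).const_sub 1
  have h4 := (h3.div h2 (by simp)).rpow_const (p := s) (by simp)
  have h5 := (h1.add (h2.mul h4)).log (by simp)
  have e : -Lam α β k s = (α * k ^ (-s) +
        (-α * ((1 - 0 * β) / (1 - 0 * α)) ^ s +
          (1 - 0 * α) *
            ((-β * (1 - 0 * α) - (1 - 0 * β) * -α) / (1 - 0 * α) ^ 2 * s *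
              ((1 - 0 * β) / (1 - 0 * α)) ^ (s - 1)))) /
      (0 * α * k ^ (-s) + (1 - 0 * α) * ((1 - 0 * β) / (1 - 0 * α)) ^ s) := by
    simp [Lam]
    ring
  rw [e]
  exact h5

/-- Uniform first-order control of the moments near `p = 0`. -/
theorem mm_bound {α β k : ℝ} (hα : 0 < α) (hα1 : α < 1) (hβα : β < α) (hk : 0 < k)
    (s : ℝ) {ε : ℝ} (hε : 0 < ε) :
    ∃ p0 > 0, ∀ p, p ∈ Set.Icc (0 : ℝ) 1 → p < p0 →
      Real.exp (-(Lam α β k s + ε) * p) ≤ mm α β k s p ∧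
      mm α β k s p ≤ Real.exp (-(Lam α β k s - ε) * p) := by
  have h := (mm_hasDeriv α β k s).isLittleO
  have h' := h.def hε
  rw [Metric.eventually_nhds_iff] at h'
  obtain ⟨p0, hp0, h'⟩ := h'
  refine ⟨p0, hp0, fun p hp hlt => ?_⟩
  have := h' (y := p) (by simpa [abs_of_nonneg hp.1] using hlt)
  simp only [mm_zero, Real.log_one, sub_zero, smul_eq_mul, Real.norm_eq_abs,
    abs_of_nonneg hp.1] at this
  rw [abs_le] at this
  have hpos := mm_pos (s := s) hα hα1 hβα hk hp
  rw [← Real.le_log_iff_exp_le hpos, ← Real.log_le_iff_le_exp hpos]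
  constructor <;> nlinarith

theorem MM_bound {α β k : ℝ} (hα : 0 < α) (hα1 : α < 1) (hβα : β < α) (hk : 0 < k)
    {s c d : ℝ} {p : ℕ → ℝ} {T0 : ℕ} (hp : ∀ t, 1 ≤ t → p t ∈ Set.Icc (0 : ℝ) 1)
    (h : ∀ t, T0 < t → Real.exp (-c * p t) ≤ mm α β k s (p t) ∧
      mm α β k s (p t) ≤ Real.exp (-d * p t)) (n : ℕ) :
    Real.exp (-c * ∑ j ∈ Finset.Ioc T0 (T0 + n), p j) ≤ MM α β k p s n T0 ∧
    MM α β k p s n T0 ≤ Real.exp (-d * ∑ j ∈ Finset.Ioc T0 (T0 + n), p j) := by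
  unfold MM
  rw [Finset.mul_sum, Finset.mul_sum, Real.exp_sum, Real.exp_sum]
  constructor
  · exact Finset.prod_le_prod (fun _ _ => (Real.exp_pos _).le)
      fun j hj => (h j (Finset.mem_Ioc.1 hj).1).1
  · refine Finset.prod_le_prod (fun j hj => (mm_pos hα hα1 hβα hk (hp j ?_)).le)
      fun j hj => (h j (Finset.mem_Ioc.1 hj).1).2
    have := (Finset.mem_Ioc.1 hj).1; omega

/-- Choice of the exponents. -/
theorem exists_exponent {α β k γ : ℝ} (hβ : 0 < β) (hβα : β < α) (hk : k = α / β)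
    (hγ : β * (1 + (k - 1) / Real.log k * (Real.log ((k - 1) / Real.log k) - 1)) < γ) :
    ∃ s δ ε : ℝ, 0 ≤ s ∧ 0 < δ ∧ 0 < ε ∧
      Lam α β k s + ε ≤ Lam α β k (s - δ) - ε ∧
      (Lam α β k s + ε) +
        s * ((Lam α β k s + ε - (Lam α β k (s + δ) - ε)) / δ) ≤ γ := by
  have hα : 0 < α := hβ.trans hβα
  have hk1 : 1 < k := by rw [hk, one_lt_div hβ]; exact hβα
  have hk0 : 0 < k := by linarith
  have hl : 0 < Real.log k := Real.log_pos hk1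
  set l := Real.log k with hldef
  have hαk : α = β * k := by rw [hk]; field_simp
  set ρ := (α - β) / l with hρ
  have hρ0 : 0 < ρ := div_pos (by linarith) hl
  have hρβ : (k - 1) / l = ρ / β := by
    rw [hρ, hαk]; field_simp
  have hρl : ρ * l = α - β := by rw [hρ]; field_simp
  set s0 := Real.log (α / ρ) / l with hs0
  have hs0n : 0 ≤ s0 := by
    apply div_nonneg _ hl.le
    apply Real.log_nonneg
    rw [one_le_div hρ0, hρ, div_le_iff₀ hl]
    have := Real.one_sub_inv_le_log_of_pos hk0
    rw [← hldef] at this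
    have h2 : α * (1 - k⁻¹) = α - β := by rw [hαk]; field_simp
    nlinarith
  have hks0 : k ^ (-s0) = ρ / α := by
    rw [Real.rpow_def_of_pos hk0, ← hldef, hs0]
    rw [show l * -(Real.log (α / ρ) / l) = -Real.log (α / ρ) by field_simp,
      ← Real.log_inv, Real.exp_log (by positivity), inv_div]
  have hL0 : Lam α β k s0 = β * (1 + (k - 1) / l * (Real.log ((k - 1) / l) - 1)) := by
    rw [hρβ, Lam, hks0]
    have h1 : l * s0 = Real.log (α / ρ) := by rw [hs0]; field_simp
    have h2 : Real.log (α / ρ) = l - Real.log (ρ / β) := by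
      rw [hldef, hk, Real.log_div hα.ne' hρ0.ne', Real.log_div hα.ne' hβ.ne',
        Real.log_div hρ0.ne' hβ.ne']; ring
    have h3 : (α - β) * s0 = ρ * (l - Real.log (ρ / β)) := by
      rw [← hρl, ← h2, ← h1]; ring
    rw [h3]
    field_simp
    nlinarith
  rw [← hL0] at hγ
  have hder : HasDerivAt (Lam α β k) 0 s0 := by
    have h1 : HasDerivAt (fun s : ℝ => k ^ (-s)) (l * (-1) * k ^ (-s0)) s0 :=
      (hasDerivAt_neg s0).const_rpow hk0
    have h2 := (((hasDerivAt_id s0).const_mul (α - β)).const_sub α).sub (h1.const_mul α)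
    have e : (0 : ℝ) = -((α - β) * 1) - α * (l * -1 * k ^ (-s0)) := by
      rw [hks0, ← hρl]; field_simp; ring
    rw [e]
    exact h2
  have hstrict : ∀ δ : ℝ, 0 < δ → Lam α β k (s0 + δ) < Lam α β k s0 := by
    intro δ hδ
    have e : k ^ (-(s0 + δ)) = ρ / α * Real.exp (-(δ * l)) := by
      rw [neg_add, Real.rpow_add hk0, hks0, Real.rpow_def_of_pos hk0 (-δ), ← hldef]
      congr 2; ring
    have := Real.add_one_lt_exp (x := -(δ * l)) (by have := mul_pos hδ hl; linarith)
    unfold Lam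
    rw [e, hks0, ← hρl]
    have e2 : α * (ρ / α * Real.exp (-(δ * l))) = ρ * Real.exp (-(δ * l)) := by field_simp
    have e3 : α * (ρ / α) = ρ := by field_simp
    rw [e2, e3]
    nlinarith
  -- the limit
  have hlim : Tendsto (fun δ : ℝ => Lam α β k s0 + (s0 + δ) *
      ((Lam α β k s0 - Lam α β k (s0 + 2 * δ)) / δ)) (nhdsWithin 0 (Set.Ioi 0))
      (nhds (Lam α β k s0 + (s0 + 0) * 0)) := by
    have t1 : Tendsto (fun δ : ℝ => s0 + δ) (nhdsWithin 0 (Set.Ioi 0)) (nhds (s0 + 0)) :=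
      (tendsto_const_nhds.add tendsto_id).mono_left nhdsWithin_le_nhds
    have t2 : Tendsto (fun δ : ℝ => (Lam α β k s0 - Lam α β k (s0 + 2 * δ)) / δ)
        (nhdsWithin 0 (Set.Ioi 0)) (nhds 0) := by
      have hd : HasDerivAt (fun δ : ℝ => Lam α β k s0 - Lam α β k (s0 + 2 * δ)) 0 0 := by
        have hi : HasDerivAt (fun δ : ℝ => s0 + 2 * δ) (2 * 1) 0 :=
          ((hasDerivAt_id (0 : ℝ)).const_mul 2).const_add s0
        have hder' : HasDerivAt (Lam α β k) 0 (s0 + 2 * 0) := by simpa using hder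
        have := (hder'.comp (0 : ℝ) hi).const_sub (Lam α β k s0)
        simpa [Function.comp_def] using this
      have := hd.tendsto_slope_zero_right
      refine this.congr fun δ => ?_
      simp [div_eq_inv_mul]
    exact tendsto_const_nhds.add (t1.mul t2)
  have hev := (hlim.eventually (gt_mem_nhds (show _ < γ by simpa using hγ))).and
    self_mem_nhdsWithin
  obtain ⟨δ, hδγ, hδ⟩ := hev.exists
  have hδ : 0 < δ := hδ
  set s := s0 + δ with hs
  have hsd : s - δ = s0 := by rw [hs]; ring
  have hsd2 : s + δ = s0 + 2 * δ := by rw [hs]; ring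
  have hst := hstrict δ hδ
  have hs' : 0 < s := by linarith
  have hγ2 : Lam α β k s + s * ((Lam α β k s - Lam α β k (s + δ)) / δ) < γ := by
    rw [hsd2]
    refine lt_of_le_of_lt ?_ hδγ
    gcongr
  set g := γ - (Lam α β k s + s * ((Lam α β k s - Lam α β k (s + δ)) / δ)) with hg
  have hg0 : 0 < g := by linarith
  set c := 1 + 2 * s / δ with hc
  have hc0 : 0 < c := by positivity
  refine ⟨s, δ, min ((Lam α β k s0 - Lam α β k s) / 2) (g / c), hs'.le, hδ,
    lt_min (by linarith) (by positivity), ?_, ?_⟩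
  · rw [hsd]
    have := min_le_left ((Lam α β k s0 - Lam α β k s) / 2) (g / c)
    linarith
  · have h1 := min_le_right ((Lam α β k s0 - Lam α β k s) / 2) (g / c)
    set ε := min ((Lam α β k s0 - Lam α β k s) / 2) (g / c)
    rw [le_div_iff₀ hc0] at h1
    have h2 : (Lam α β k s + ε) + s * ((Lam α β k s + ε - (Lam α β k (s + δ) - ε)) / δ)
        = (γ - g) + ε * c := by
      rw [hg, hc]; field_simp; ring
    rw [h2]; linarith

/-- Main analytic estimate. -/
theorem Phi_exp {α β k γ : ℝ} {p : ℕ → ℝ} (hβ : 0 < β) (hβα : β < α) (hα1 : α < 1)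
    (hk : k = α / β) (hp : ∀ t, 1 ≤ t → p t ∈ Set.Icc (0 : ℝ) 1)
    (hγ : β * (1 + (k - 1) / Real.log k * (Real.log ((k - 1) / Real.log k) - 1)) < γ)
    (hlim : Tendsto p atTop (nhds 0)) :
    ∃ T1, ∀ T, T1 ≤ T → ∀ r, k < r → ∃ C > 0, ∀ n,
      C * Real.exp (-γ * ∑ j ∈ Finset.Ioc T (T + n), p j) ≤ Phi α β k p n T r := by
  have hα : 0 < α := hβ.trans hβα
  have hk0 : 0 < k := by rw [hk]; positivity
  obtain ⟨s, δ, ε, hs, hδ, hε, h1, h2⟩ := exists_exponent hβ hβα hk hγ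
  obtain ⟨p1, hp1, b1⟩ := mm_bound hα hα1 hβα hk0 s hε
  obtain ⟨p2, hp2, b2⟩ := mm_bound hα hα1 hβα hk0 (s - δ) hε
  obtain ⟨p3, hp3, b3⟩ := mm_bound hα hα1 hβα hk0 (s + δ) hε
  have hev := ((hlim.eventually (gt_mem_nhds hp1)).and ((hlim.eventually (gt_mem_nhds hp2)).and
    (hlim.eventually (gt_mem_nhds hp3))))
  obtain ⟨T1, hT1⟩ := eventually_atTop.1 hev
  refine ⟨T1, fun T hT r hr => ?_⟩
  have hr0 : 0 < r := hk0.trans hr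
  have hc0 : 0 < r ^ s - k ^ δ * r ^ (s - δ) := by
    have : r ^ s = r ^ δ * r ^ (s - δ) := by
      rw [← Real.rpow_add hr0]; congr 1; ring
    rw [this]
    have := Real.rpow_lt_rpow hk0.le hr hδ
    have := Real.rpow_pos_of_pos hr0 (s - δ)
    nlinarith
  set c0 := r ^ s - k ^ δ * r ^ (s - δ) with hc0d
  have hd0 : 0 < r ^ (s + δ) := Real.rpow_pos_of_pos hr0 _
  set d0 := r ^ (s + δ) with hd0d
  set A := Lam α β k s + ε with hA
  set B := Lam α β k (s + δ) - ε with hB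
  set K0 := (2 * d0 / c0) ^ (δ⁻¹) with hK0
  have hK0p : 0 < K0 := Real.rpow_pos_of_pos (by positivity) _
  have hK0δ : K0 ^ (-δ) = c0 / (2 * d0) := by
    rw [hK0, ← Real.rpow_mul (by positivity), mul_neg, inv_mul_cancel₀ hδ.ne',
      Real.rpow_neg_one, inv_div]
  refine ⟨K0 ^ (-s) * (c0 / 2), by positivity, fun n => ?_⟩
  set S := ∑ j ∈ Finset.Ioc T (T + n), p j with hS
  have hS0 : 0 ≤ S := Finset.sum_nonneg fun j hj => (hp j (by
    have := (Finset.mem_Ioc.1 hj).1; omega)).1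
  have hpm : ∀ t, T < t → p t ∈ Set.Icc (0 : ℝ) 1 := fun t ht => hp t (by omega)
  have M1 := (MM_bound hα hα1 hβα hk0 (T0 := T) hp (fun t ht => b1 (p t) (hpm t ht)
    (hT1 t (by omega)).1) n).1
  have M3 := (MM_bound hα hα1 hβα hk0 (T0 := T) hp (fun t ht => b3 (p t) (hpm t ht)
    (hT1 t (by omega)).2.2) n).2
  rw [← hS] at M1
  rw [← hS] at M3
  set K := K0 * Real.exp (S * ((A - B) / δ)) with hK
  have hKp : 0 < K := by positivity
  have hKσ : ∀ σ : ℝ, K ^ (-σ) = K0 ^ (-σ) * Real.exp (-(S * ((A - B) / δ)) * σ) := by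
    intro σ
    rw [hK, Real.mul_rpow hK0p.le (Real.exp_pos _).le, ← Real.exp_mul]; congr 2; ring
  have main := Phi_lower (p := p) hα hα1 hβα hk0 hs hδ.le hKp T hp (fun t ht => by
    have u1 := (b1 (p t) (hpm t ht) (hT1 t (by omega)).1).1
    have u2 := (b2 (p t) (hpm t ht) (hT1 t (by omega)).2.1).2
    refine u2.trans (le_trans ?_ u1)
    apply Real.exp_le_exp.2
    have := (hpm t ht).1
    nlinarith) n T r le_rfl hr0
  refine le_trans ?_ main
  rw [← hc0d, ← hd0d]
  have z1 : K ^ (-δ) * (MM α β k p (s + δ) n T * d0) ≤ c0 / 2 * Real.exp (-A * S) := by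
    calc K ^ (-δ) * (MM α β k p (s + δ) n T * d0)
        ≤ K ^ (-δ) * (Real.exp (-B * S) * d0) := by gcongr
      _ = c0 / 2 * (Real.exp (-(S * ((A - B) / δ)) * δ) * Real.exp (-B * S)) := by
          rw [hKσ, hK0δ]; field_simp
      _ = c0 / 2 * Real.exp (-A * S) := by
          rw [← Real.exp_add]; congr 2; field_simp; ring
  have z2 : Real.exp (-A * S) * c0 ≤ MM α β k p s n T * c0 := by gcongr
  calc K0 ^ (-s) * (c0 / 2) * Real.exp (-γ * S)
      ≤ K0 ^ (-s) * (c0 / 2) * Real.exp (-(S * ((A - B) / δ)) * s + -A * S) := by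
        gcongr
        have := mul_le_mul_of_nonneg_left h2 hS0
        nlinarith
    _ = K ^ (-s) * (c0 / 2 * Real.exp (-A * S)) := by
        rw [Real.exp_add, hKσ]; ring
    _ ≤ _ := by
        apply mul_le_mul_of_nonneg_left _ (by positivity)
        linarith

section Prob
variable {a b : ℝ} {p : ℕ → ℝ} {Ω : Type*} [MeasurableSpace Ω] {μ : Measure Ω} {θ : Ω → ℕ}
  {X I Z : ℕ → Ω → ℕ}

/-- Unnormalised likelihood of a history. -/
def LL {Ω : Type*} [MeasurableSpace Ω] (μ : Measure Ω) (θ : Ω → ℕ) (Z : ℕ → Ω → ℕ)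
    (i T : ℕ) (z : ℕ → ℕ) : ℝ :=
  μ.real {ω | θ ω = i ∧ ∀ s ∈ Finset.Icc 1 T, Z s ω = z s}

theorem mapEst_congr (t : ℕ) (ω ω' : Ω)
    (h : ∀ s ∈ Finset.Icc 1 (t - 1), Z s ω = Z s ω') (hX : X t ω = X t ω') :
    mapEst μ θ X Z t ω = mapEst μ θ X Z t ω' := by
  have hD : ∀ i, Dlike μ θ X Z t i ω = Dlike μ θ X Z t i ω' := by
    intro i
    unfold Dlike
    have : {ω'' | θ ω'' = i ∧ (∀ s ∈ Finset.Icc 1 (t - 1), Z s ω'' = Z s ω) ∧ X t ω'' = X t ω}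
      = {ω'' | θ ω'' = i ∧ (∀ s ∈ Finset.Icc 1 (t - 1), Z s ω'' = Z s ω') ∧
        X t ω'' = X t ω'} := by
      ext ω''
      simp only [Set.mem_ofPred_eq, hX]
      refine and_congr_right fun _ => and_congr_left fun _ => ?_
      exact forall₂_congr fun s hs => by rw [h s hs]
    rw [this]
  unfold mapEst
  rw [hD, hD, hX]

theorem Z_determined (hC : IsCascade a b p μ θ X I Z) (ω ω' : Ω) (T : ℕ)
    (h : ∀ s ∈ Finset.Icc 1 T, X s ω = X s ω' ∧ I s ω = I s ω') :
    ∀ t ∈ Finset.Icc 1 T, Z t ω = Z t ω' := by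
  intro t
  induction t using Nat.strong_induction_on with
  | _ t ih =>
    intro ht
    have ht' := Finset.mem_Icc.1 ht
    rw [hC.dynamics t ht'.1, hC.dynamics t ht'.1, (h t ht).1, (h t ht).2,
      mapEst_congr t ω ω' (fun s hs => ?_) (h t ht).1]
    have hs' := Finset.mem_Icc.1 hs
    exact ih s (by omega) (Finset.mem_Icc.2 ⟨hs'.1, by omega⟩)

theorem meas_hist (hC : IsCascade a b p μ θ X I Z) (i T : ℕ) (z : ℕ → ℕ) :
    MeasurableSet {ω | θ ω = i ∧ ∀ s ∈ Finset.Icc 1 T, Z s ω = z s} := by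
  have : {ω | θ ω = i ∧ ∀ s ∈ Finset.Icc 1 T, Z s ω = z s}
      = θ ⁻¹' {i} ∩ ⋂ s ∈ Finset.Icc 1 T, (Z s) ⁻¹' {z s} := by
    ext; simp
  rw [this]
  exact MeasurableSet.inter (hC.theta_meas (measurableSet_singleton i))
    (Finset.measurableSet_biInter _ fun s _ => hC.Z_meas s (measurableSet_singleton _))

/-- The vector of signals and indicators up to time `T`. -/
def WW {Ω : Type*} (X I : ℕ → Ω → ℕ) (T : ℕ) (ω : Ω) : Fin T → Bool × Bool :=
  fun r => (decide (X (r + 1) ω = 1), decide (I (r + 1) ω = 1))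

/-- decoding of signals -/
def dX (T : ℕ) (v : Fin T → Bool × Bool) (t : ℕ) : ℕ :=
  if h : t - 1 < T then (if (v ⟨t - 1, h⟩).1 then 1 else 2) else 1

/-- decoding of indicators -/
def dI (T : ℕ) (v : Fin T → Bool × Bool) (t : ℕ) : ℕ :=
  if h : t - 1 < T then (if (v ⟨t - 1, h⟩).2 then 1 else 0) else 0

theorem dX_range (T : ℕ) (v : Fin T → Bool × Bool) (t : ℕ) : dX T v t = 1 ∨ dX T v t = 2 := by
  unfold dX; split_ifs <;> simp

theorem dI_range (T : ℕ) (v : Fin T → Bool × Bool) (t : ℕ) : dI T v t = 0 ∨ dI T v t = 1 := by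
  unfold dI; split_ifs <;> simp

theorem WW_eq_iff (hC : IsCascade a b p μ θ X I Z) (T : ℕ) (v : Fin T → Bool × Bool) (ω : Ω) :
    WW X I T ω = v ↔ ∀ t ∈ Finset.Icc 1 T, X t ω = dX T v t ∧ I t ω = dI T v t := by
  constructor
  · rintro rfl t ht
    have ht' := Finset.mem_Icc.1 ht
    have h1 : t - 1 < T := by omega
    have h2 : t - 1 + 1 = t := by omega
    simp only [dX, dI, WW, h1, dif_pos, h2, decide_eq_true_eq]
    rcases hC.X_range t ω with h | h <;> rcases hC.I_range t ω with h' | h' <;> simp [h, h']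
  · intro h
    funext r
    have hr := h (r + 1) (Finset.mem_Icc.2 ⟨by omega, by omega⟩)
    have h1 : (r : ℕ) + 1 - 1 < T := by omega
    simp only [dX, dI, add_tsub_cancel_right, r.2, dif_pos] at hr
    unfold WW
    rw [hr.1, hr.2]
    ext <;> cases hh : v r <;> rename_i x y <;> cases x <;> cases y <;> simp

theorem meas_WW (hC : IsCascade a b p μ θ X I Z) (T : ℕ) (v : Fin T → Bool × Bool) :
    MeasurableSet {ω | WW X I T ω = v} := by
  have : {ω | WW X I T ω = v}
      = ⋂ t ∈ Finset.Icc 1 T, ((X t) ⁻¹' {dX T v t} ∩ (I t) ⁻¹' {dI T v t}) := by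
    ext ω; simp [WW_eq_iff hC]
  exact this ▸ Finset.measurableSet_biInter _ fun s _ =>
    (hC.X_meas s (measurableSet_singleton _)).inter (hC.I_meas s (measurableSet_singleton _))

theorem sum_WW (hC : IsCascade a b p μ θ X I Z) (T : ℕ) {A : Set Ω} (hA : MeasurableSet A) :
    μ.real A = ∑ v : Fin T → Bool × Bool, μ.real (A ∩ {ω | WW X I T ω = v}) := by
  have := hC.prob
  have hU : A = ⋃ v ∈ (Finset.univ : Finset (Fin T → Bool × Bool)),
      (A ∩ {ω | WW X I T ω = v}) := by
    ext ω; simp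
  conv_lhs => rw [hU]
  rw [measureReal_biUnion_finset]
  · intro v _ w _ hvw
    change Disjoint _ _
    rw [Set.disjoint_left]
    rintro ω ⟨_, h1⟩ ⟨_, h2⟩
    exact hvw (h1.symm.trans h2)
  · exact fun v _ => hA.inter (meas_WW hC T v)

theorem cyl (hC : IsCascade a b p μ θ X I Z) {i : ℕ} (hi : i = 1 ∨ i = 2) (T : ℕ)
    (v : Fin T → Bool × Bool) {x c : ℕ} (hx : x = 1 ∨ x = 2) (hc : c = 0 ∨ c = 1) :
    μ.real {ω | θ ω = i ∧ WW X I T ω = v ∧ X (T + 1) ω = x ∧ I (T + 1) ω = c}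
      = μ.real {ω | θ ω = i ∧ WW X I T ω = v} *
        (signalProb a b i x * (if c = 1 then p (T + 1) else 1 - p (T + 1))) := by
  have h1 := hC.joint i hi (Finset.Icc 1 T) (fun t ht => (Finset.mem_Icc.1 ht).1)
    (dX T v) (dI T v) (dX_range T v) (dI_range T v)
  have h2 := hC.joint i hi (Finset.Icc 1 (T + 1)) (fun t ht => (Finset.mem_Icc.1 ht).1)
    (fun t => if t = T + 1 then x else dX T v t) (fun t => if t = T + 1 then c else dI T v t)
    (fun t => by split_ifs; exacts [hx, dX_range T v t])
    (fun t => by split_ifs; exacts [hc, dI_range T v t])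
  have hIcc : Finset.Icc 1 (T + 1) = insert (T + 1) (Finset.Icc 1 T) := by
    ext t; simp only [Finset.mem_Icc, Finset.mem_insert]; omega
  have hne : ∀ t ∈ Finset.Icc 1 T, t ≠ T + 1 := fun t ht => by
    have := (Finset.mem_Icc.1 ht).2; omega
  have e1 : {ω | θ ω = i ∧ WW X I T ω = v}
      = {ω | θ ω = i ∧ ∀ t ∈ Finset.Icc 1 T, X t ω = dX T v t ∧ I t ω = dI T v t} := by
    ext ω; simp only [Set.mem_ofPred_eq, WW_eq_iff hC]
  have e2 : {ω | θ ω = i ∧ WW X I T ω = v ∧ X (T + 1) ω = x ∧ I (T + 1) ω = c}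
      = {ω | θ ω = i ∧ ∀ t ∈ Finset.Icc 1 (T + 1),
          X t ω = (if t = T + 1 then x else dX T v t) ∧
          I t ω = (if t = T + 1 then c else dI T v t)} := by
    ext ω
    simp only [Set.mem_ofPred_eq, WW_eq_iff hC, hIcc, Finset.forall_mem_insert, if_true]
    refine and_congr_right fun _ => ?_
    rw [and_comm]
    refine and_congr_right fun _ => forall₂_congr fun t ht => ?_
    simp [hne t ht]
  rw [e1, e2, Measure.real, Measure.real, h1, h2, hIcc, Finset.prod_insert (by simp)]
  simp only [if_true]
  rw [Finset.prod_congr rfl (fun t ht => by rw [if_neg (hne t ht), if_neg (hne t ht)])]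
  ring

theorem indep_step (hC : IsCascade a b p μ θ X I Z) {i : ℕ} (hi : i = 1 ∨ i = 2) (T : ℕ)
    (z : ℕ → ℕ) {x c : ℕ} (hx : x = 1 ∨ x = 2) (hc : c = 0 ∨ c = 1) :
    μ.real {ω | (θ ω = i ∧ ∀ s ∈ Finset.Icc 1 T, Z s ω = z s) ∧
        (X (T + 1) ω = x ∧ I (T + 1) ω = c)}
      = LL μ θ Z i T z *
        (signalProb a b i x * (if c = 1 then p (T + 1) else 1 - p (T + 1))) := by
  have hm := meas_hist hC i T z
  have hm2 : MeasurableSet {ω | X (T + 1) ω = x ∧ I (T + 1) ω = c} := by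
    have : {ω | X (T + 1) ω = x ∧ I (T + 1) ω = c}
      = (X (T + 1)) ⁻¹' {x} ∩ (I (T + 1)) ⁻¹' {c} := by ext; simp
    rw [this]
    exact (hC.X_meas _ (measurableSet_singleton _)).inter (hC.I_meas _ (measurableSet_singleton _))
  have hm3 : MeasurableSet {ω | (θ ω = i ∧ ∀ s ∈ Finset.Icc 1 T, Z s ω = z s) ∧
        (X (T + 1) ω = x ∧ I (T + 1) ω = c)} := hm.inter hm2
  rw [LL, sum_WW hC T hm3, sum_WW hC T hm, Finset.sum_mul]
  refine Finset.sum_congr rfl fun v _ => ?_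
  by_cases hv : ∃ ω, WW X I T ω = v ∧ ∀ s ∈ Finset.Icc 1 T, Z s ω = z s
  · obtain ⟨ω0, h0, hz0⟩ := hv
    have hdet : ∀ ω, WW X I T ω = v → ∀ s ∈ Finset.Icc 1 T, Z s ω = z s := by
      intro ω hω s hs
      rw [← hz0 s hs]
      refine Z_determined hC ω ω0 T (fun t ht => ?_) s hs
      have g1 := (WW_eq_iff hC T v ω).1 hω t ht
      have g2 := (WW_eq_iff hC T v ω0).1 h0 t ht
      exact ⟨g1.1.trans g2.1.symm, g1.2.trans g2.2.symm⟩
    have e1 : {ω | (θ ω = i ∧ ∀ s ∈ Finset.Icc 1 T, Z s ω = z s) ∧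
        (X (T + 1) ω = x ∧ I (T + 1) ω = c)} ∩ {ω | WW X I T ω = v}
        = {ω | θ ω = i ∧ WW X I T ω = v ∧ X (T + 1) ω = x ∧ I (T + 1) ω = c} := by
      ext ω
      simp only [Set.mem_inter_iff, Set.mem_ofPred_eq]
      constructor
      · rintro ⟨⟨⟨h1, _⟩, h2⟩, h3⟩; exact ⟨h1, h3, h2⟩
      · rintro ⟨h1, h3, h2⟩; exact ⟨⟨⟨h1, hdet ω h3⟩, h2⟩, h3⟩
    have e2 : {ω | (θ ω = i ∧ ∀ s ∈ Finset.Icc 1 T, Z s ω = z s)} ∩ {ω | WW X I T ω = v}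
        = {ω | θ ω = i ∧ WW X I T ω = v} := by
      ext ω
      simp only [Set.mem_inter_iff, Set.mem_ofPred_eq]
      constructor
      · rintro ⟨⟨h1, _⟩, h3⟩; exact ⟨h1, h3⟩
      · rintro ⟨h1, h3⟩; exact ⟨⟨h1, hdet ω h3⟩, h3⟩
    rw [e1, e2]
    exact cyl hC hi T v hx hc
  · have e1 : {ω | (θ ω = i ∧ ∀ s ∈ Finset.Icc 1 T, Z s ω = z s) ∧
        (X (T + 1) ω = x ∧ I (T + 1) ω = c)} ∩ {ω | WW X I T ω = v} = ∅ := by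
      ext ω
      simp only [Set.mem_inter_iff, Set.mem_ofPred_eq, Set.mem_empty_iff_false, iff_false]
      rintro ⟨⟨⟨_, h⟩, _⟩, h'⟩
      exact hv ⟨ω, h', h⟩
    have e2 : {ω | (θ ω = i ∧ ∀ s ∈ Finset.Icc 1 T, Z s ω = z s)} ∩ {ω | WW X I T ω = v} = ∅ := by
      ext ω
      simp only [Set.mem_inter_iff, Set.mem_ofPred_eq, Set.mem_empty_iff_false, iff_false]
      rintro ⟨⟨_, h⟩, h'⟩
      exact hv ⟨ω, h', h⟩
    rw [e1, e2]; simp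

theorem indep_X (hC : IsCascade a b p μ θ X I Z) {i : ℕ} (hi : i = 1 ∨ i = 2) (T : ℕ)
    (z : ℕ → ℕ) {x : ℕ} (hx : x = 1 ∨ x = 2) :
    μ.real {ω | (θ ω = i ∧ ∀ s ∈ Finset.Icc 1 T, Z s ω = z s) ∧ X (T + 1) ω = x}
      = LL μ θ Z i T z * signalProb a b i x := by
  have := hC.prob
  have h0 := indep_step hC hi T z hx (c := 0) (Or.inl rfl)
  have h1 := indep_step hC hi T z hx (c := 1) (Or.inr rfl)
  have hm : MeasurableSet {ω | I (T + 1) ω = 1} := hC.I_meas _ (measurableSet_singleton 1)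
  rw [← measureReal_inter_add_sdiff (s := {ω | (θ ω = i ∧ ∀ s ∈ Finset.Icc 1 T, Z s ω = z s) ∧
    X (T + 1) ω = x}) (ht := hm)]
  have e1 : {ω | (θ ω = i ∧ ∀ s ∈ Finset.Icc 1 T, Z s ω = z s) ∧ X (T + 1) ω = x} ∩
      {ω | I (T + 1) ω = 1} = {ω | (θ ω = i ∧ ∀ s ∈ Finset.Icc 1 T, Z s ω = z s) ∧
        (X (T + 1) ω = x ∧ I (T + 1) ω = 1)} := by
    ext ω; simp only [Set.mem_inter_iff, Set.mem_ofPred_eq]; tauto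
  have e0 : {ω | (θ ω = i ∧ ∀ s ∈ Finset.Icc 1 T, Z s ω = z s) ∧ X (T + 1) ω = x} \
      {ω | I (T + 1) ω = 1} = {ω | (θ ω = i ∧ ∀ s ∈ Finset.Icc 1 T, Z s ω = z s) ∧
        (X (T + 1) ω = x ∧ I (T + 1) ω = 0)} := by
    ext ω; simp only [Set.mem_sdiff, Set.mem_ofPred_eq]
    rcases hC.I_range (T + 1) ω with h | h <;> simp [h, and_assoc]
  rw [e1, e0, h0, h1]
  simp
  ring

theorem half (hC : IsCascade a b p μ θ X I Z) {i : ℕ} (hi : i = 1 ∨ i = 2) :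
    (μ {ω | θ ω = i}).toReal = 1 / 2 := by
  have := hC.joint i hi ∅ (by simp) (fun _ => 1) (fun _ => 0) (by simp) (by simp)
  simpa using this

theorem Dlike_eq (hC : IsCascade a b p μ θ X I Z) {i : ℕ} (hi : i = 1 ∨ i = 2) (T : ℕ)
    (z : ℕ → ℕ) (ω : Ω) (hω : ∀ s ∈ Finset.Icc 1 T, Z s ω = z s) :
    Dlike μ θ X Z (T + 1) i ω
      = 2 * (LL μ θ Z i T z * signalProb a b i (X (T + 1) ω)) := by
  rw [← indep_X hC hi T z (hC.X_range (T + 1) ω)]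
  unfold Dlike
  rw [half hC hi, Measure.real]
  have : {ω' | θ ω' = i ∧ (∀ s ∈ Finset.Icc 1 (T + 1 - 1), Z s ω' = Z s ω) ∧
      X (T + 1) ω' = X (T + 1) ω}
      = {ω' | (θ ω' = i ∧ ∀ s ∈ Finset.Icc 1 T, Z s ω' = z s) ∧
        X (T + 1) ω' = X (T + 1) ω} := by
    ext ω'
    simp only [Set.mem_ofPred_eq, add_tsub_cancel_right, and_assoc]
    refine and_congr_right fun _ => and_congr_left fun _ => ?_
    exact forall₂_congr fun s hs => by rw [hω s hs]
  rw [this]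
  ring

theorem LL_nonneg (i T : ℕ) (z : ℕ → ℕ) : 0 ≤ LL μ θ Z i T z := measureReal_nonneg

theorem mapEst_good (hC : IsCascade a b p μ θ X I Z) (hb : 0 < b) (hab : b < a) (T : ℕ)
    (z : ℕ → ℕ) (hg : a * LL μ θ Z 2 T z < b * LL μ θ Z 1 T z) (ω : Ω)
    (hω : ∀ s ∈ Finset.Icc 1 T, Z s ω = z s) : mapEst μ θ X Z (T + 1) ω = 1 := by
  have hs : 0 < a + b := by linarith
  have n2 : 0 ≤ LL μ θ Z 2 T z := LL_nonneg 2 T z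
  have n1 : 0 ≤ LL μ θ Z 1 T z := LL_nonneg 1 T z
  unfold mapEst
  rw [if_pos]
  rw [Dlike_eq hC (Or.inl rfl) T z ω hω, Dlike_eq hC (Or.inr rfl) T z ω hω]
  have : LL μ θ Z 2 T z * signalProb a b 2 (X (T + 1) ω)
      < LL μ θ Z 1 T z * signalProb a b 1 (X (T + 1) ω) := by
    rcases hC.X_range (T + 1) ω with h | h <;> simp only [signalProb, h]
    · norm_num
      rw [← mul_div_assoc, ← mul_div_assoc]
      apply div_lt_div_of_pos_right _ hs
      nlinarith
    · norm_num
      rw [← mul_div_assoc, ← mul_div_assoc]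
      apply div_lt_div_of_pos_right _ hs
      nlinarith
  linarith

theorem mapEst_mid (hC : IsCascade a b p μ θ X I Z) (hb : 0 < b) (hab : b < a) (T : ℕ)
    (z : ℕ → ℕ) (h1 : b * LL μ θ Z 1 T z ≤ a * LL μ θ Z 2 T z)
    (h2 : b * LL μ θ Z 2 T z ≤ a * LL μ θ Z 1 T z) (ω : Ω)
    (hω : ∀ s ∈ Finset.Icc 1 T, Z s ω = z s) :
    mapEst μ θ X Z (T + 1) ω = X (T + 1) ω := by
  have hs : 0 < a + b := by linarith
  unfold mapEst
  rw [Dlike_eq hC (Or.inl rfl) T z ω hω, Dlike_eq hC (Or.inr rfl) T z ω hω]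
  rcases hC.X_range (T + 1) ω with h | h <;> simp only [signalProb, h]
  · have : LL μ θ Z 2 T z * (b / (a + b)) ≤ LL μ θ Z 1 T z * (a / (a + b)) := by
      rw [← mul_div_assoc, ← mul_div_assoc]
      apply div_le_div_of_nonneg_right _ hs.le
      nlinarith
    norm_num
    intro _
    exact this
  · have : LL μ θ Z 1 T z * (b / (a + b)) ≤ LL μ θ Z 2 T z * (a / (a + b)) := by
      rw [← mul_div_assoc, ← mul_div_assoc]
      apply div_le_div_of_nonneg_right _ hs.le
      nlinarith
    norm_num
    exact this

theorem Z_range (hC : IsCascade a b p μ θ X I Z) (t : ℕ) (ht : 1 ≤ t) (ω : Ω) :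
    Z t ω = 1 ∨ Z t ω = 2 := by
  rw [hC.dynamics t ht]
  split_ifs
  · exact hC.X_range t ω
  · unfold mapEst
    split_ifs
    exacts [Or.inl rfl, Or.inr rfl, hC.X_range t ω]

theorem hist_update {Ω : Type*} {Z : ℕ → Ω → ℕ} (T x : ℕ) (z : ℕ → ℕ) (ω : Ω) :
    (∀ s ∈ Finset.Icc 1 (T + 1), Z s ω = Function.update z (T + 1) x s)
      ↔ (∀ s ∈ Finset.Icc 1 T, Z s ω = z s) ∧ Z (T + 1) ω = x := by
  have hIcc : Finset.Icc 1 (T + 1) = insert (T + 1) (Finset.Icc 1 T) := by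
    ext t; simp only [Finset.mem_Icc, Finset.mem_insert]; omega
  rw [hIcc, Finset.forall_mem_insert, Function.update_self, and_comm]
  refine and_congr_left fun _ => forall₂_congr fun s hs => ?_
  have := (Finset.mem_Icc.1 hs).2
  rw [Function.update_of_ne (by omega)]

theorem LL_add (hC : IsCascade a b p μ θ X I Z) (i T : ℕ) (z : ℕ → ℕ) :
    LL μ θ Z i (T + 1) (Function.update z (T + 1) 1) +
      LL μ θ Z i (T + 1) (Function.update z (T + 1) 2) = LL μ θ Z i T z := by
  have := hC.prob
  have hm : MeasurableSet {ω | Z (T + 1) ω = 1} := hC.Z_meas _ (measurableSet_singleton 1)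
  unfold LL
  rw [← measureReal_inter_add_sdiff (s := {ω | θ ω = i ∧ ∀ s ∈ Finset.Icc 1 T, Z s ω = z s})
    (ht := hm)]
  simp only [hist_update]
  congr 2
  · ext ω; simp only [Set.mem_inter_iff, Set.mem_ofPred_eq, and_assoc]
  · ext ω; simp only [Set.mem_sdiff, Set.mem_ofPred_eq, and_assoc]
    rcases Z_range hC (T + 1) (by omega) ω with h | h <;> simp [h]

theorem LL_good_two (hC : IsCascade a b p μ θ X I Z) (hb : 0 < b) (hab : b < a) {i : ℕ}
    (hi : i = 1 ∨ i = 2) (T : ℕ)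
    (z : ℕ → ℕ) (hg : a * LL μ θ Z 2 T z < b * LL μ θ Z 1 T z) :
    LL μ θ Z i (T + 1) (Function.update z (T + 1) 2)
      = LL μ θ Z i T z * (signalProb a b i 2 * p (T + 1)) := by
  have h := indep_step hC hi T z (x := 2) (c := 1) (Or.inr rfl) (Or.inr rfl)
  rw [if_pos rfl] at h
  rw [← h]
  unfold LL
  simp only [hist_update]
  congr 1
  ext ω
  simp only [Set.mem_ofPred_eq, and_assoc]
  refine and_congr_right fun _ => and_congr_right fun hz => ?_
  rw [hC.dynamics (T + 1) (by omega), mapEst_good hC hb hab T z hg ω hz]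
  split_ifs with h <;> simp [h]

theorem LL_mid_one (hC : IsCascade a b p μ θ X I Z) (hb : 0 < b) (hab : b < a) {i : ℕ}
    (hi : i = 1 ∨ i = 2) (T : ℕ)
    (z : ℕ → ℕ) (h1 : b * LL μ θ Z 1 T z ≤ a * LL μ θ Z 2 T z)
    (h2 : b * LL μ θ Z 2 T z ≤ a * LL μ θ Z 1 T z) :
    LL μ θ Z i (T + 1) (Function.update z (T + 1) 1)
      = LL μ θ Z i T z * signalProb a b i 1 := by
  rw [← indep_X hC hi T z (x := 1) (Or.inl rfl)]
  unfold LL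
  simp only [hist_update]
  congr 1
  ext ω
  simp only [Set.mem_ofPred_eq, and_assoc]
  refine and_congr_right fun _ => and_congr_right fun hz => ?_
  rw [hC.dynamics (T + 1) (by omega), mapEst_mid hC hb hab T z h1 h2 ω hz]
  split_ifs <;> rfl

theorem casc (hC : IsCascade a b p μ θ X I Z) (hb : 0 < b) (hab : b < a) (n : ℕ) :
    ∀ T z, 0 < LL μ θ Z 2 T z →
      b / (a + b) * (LL μ θ Z 2 T z * Phi (a / (a + b)) (b / (a + b)) (a / b) p n T
        (LL μ θ Z 1 T z / LL μ θ Z 2 T z))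
      ≤ μ.real {ω | (θ ω = 2 ∧ ∀ s ∈ Finset.Icc 1 T, Z s ω = z s) ∧ Z (T + n + 1) ω = 1} := by
  have := hC.prob
  have ha : 0 < a := hb.trans hab
  have hs : 0 < a + b := by linarith
  have hgood : ∀ T z, 0 < LL μ θ Z 2 T z → a / b < LL μ θ Z 1 T z / LL μ θ Z 2 T z →
      a * LL μ θ Z 2 T z < b * LL μ θ Z 1 T z := by
    intro T z h0 h
    rw [div_lt_div_iff₀ hb h0] at h
    linarith
  have hαβ : 1 - a / (a + b) = b / (a + b) := by field_simp; ring
  have s2 : signalProb a b 2 2 = a / (a + b) := by simp [signalProb]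
  have s1 : signalProb a b 1 2 = b / (a + b) := by simp [signalProb]
  have hα : 0 < a / (a + b) := by positivity
  have hβ : 0 < b / (a + b) := by positivity
  set α := a / (a + b) with hαd
  set β := b / (a + b) with hβd
  have hkαβ : a / b = α / β := by rw [hαd, hβd]; field_simp
  induction n with
  | zero =>
    intro T z h0
    by_cases hk : a / b < LL μ θ Z 1 T z / LL μ θ Z 2 T z
    · have hg := hgood T z h0 hk
      have h1 := LL_add hC 2 T z
      have h2 := LL_good_two hC hb hab (Or.inr rfl) T z hg
      have hp := hC.p_mem (T + 1) (by omega)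
      have e : μ.real {ω | (θ ω = 2 ∧ ∀ s ∈ Finset.Icc 1 T, Z s ω = z s) ∧ Z (T + 0 + 1) ω = 1}
          = LL μ θ Z 2 (T + 1) (Function.update z (T + 1) 1) := by
        unfold LL
        simp only [hist_update, and_assoc, add_zero]
      rw [e]
      rw [s2] at h2
      simp only [Phi, hk, if_true, mul_one]
      have : LL μ θ Z 2 T z * (α * p (T + 1)) ≤ LL μ θ Z 2 T z * α := by
        apply mul_le_mul_of_nonneg_left _ h0.le
        nlinarith [hp.2]
      nlinarith
    · simp only [Phi, hk, if_false, mul_zero]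
      exact measureReal_nonneg
  | succ n ih =>
    intro T z h0
    by_cases hk : a / b < LL μ θ Z 1 T z / LL μ θ Z 2 T z
    · have hg := hgood T z h0 hk
      have hp := hC.p_mem (T + 1) (by omega)
      have a1 := LL_add hC 1 T z
      have a2 := LL_add hC 2 T z
      have g1 := LL_good_two hC hb hab (i := 1) (Or.inl rfl) T z hg
      have g2 := LL_good_two hC hb hab (i := 2) (Or.inr rfl) T z hg
      rw [s1] at g1
      rw [s2] at g2
      simp only [Phi, hk, if_true]
      have i1 := ih (T + 1) (Function.update z (T + 1) 1)
      have i2 := ih (T + 1) (Function.update z (T + 1) 2)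
      have hm : MeasurableSet {ω | Z (T + 1) ω = 1} := hC.Z_meas _ (measurableSet_singleton 1)
      have hsplit := measureReal_inter_add_sdiff (μ := μ)
        (s := {ω | (θ ω = 2 ∧ ∀ s ∈ Finset.Icc 1 T, Z s ω = z s) ∧ Z (T + (n + 1) + 1) ω = 1})
        (ht := hm)
      have e1 : {ω | (θ ω = 2 ∧ ∀ s ∈ Finset.Icc 1 T, Z s ω = z s) ∧ Z (T + (n + 1) + 1) ω = 1}
          ∩ {ω | Z (T + 1) ω = 1} = {ω | (θ ω = 2 ∧ ∀ s ∈ Finset.Icc 1 (T + 1),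
            Z s ω = Function.update z (T + 1) 1 s) ∧ Z (T + 1 + n + 1) ω = 1} := by
        ext ω
        simp only [hist_update, Set.mem_inter_iff, Set.mem_ofPred_eq,
          show T + (n + 1) + 1 = T + 1 + n + 1 by omega]
        tauto
      have e2 : {ω | (θ ω = 2 ∧ ∀ s ∈ Finset.Icc 1 T, Z s ω = z s) ∧ Z (T + (n + 1) + 1) ω = 1}
          \ {ω | Z (T + 1) ω = 1} = {ω | (θ ω = 2 ∧ ∀ s ∈ Finset.Icc 1 (T + 1),
            Z s ω = Function.update z (T + 1) 2 s) ∧ Z (T + 1 + n + 1) ω = 1} := by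
        ext ω
        simp only [hist_update, Set.mem_sdiff, Set.mem_ofPred_eq,
          show T + (n + 1) + 1 = T + 1 + n + 1 by omega]
        rcases Z_range hC (T + 1) (by omega) ω with h | h <;> simp [h]
      rw [e1, e2] at hsplit
      rw [← hsplit]
      have hα1 : 0 < 1 - p (T + 1) * α := by nlinarith [hp.1, hp.2]
      have f1 : LL μ θ Z 1 (T + 1) (Function.update z (T + 1) 1)
          = LL μ θ Z 1 T z * (1 - p (T + 1) * β) := by linarith
      have f2 : LL μ θ Z 2 (T + 1) (Function.update z (T + 1) 1)
          = LL μ θ Z 2 T z * (1 - p (T + 1) * α) := by linarith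
      rw [f1, f2] at i1
      rw [g1, g2] at i2
      have j1 := i1 (by positivity)
      have r1 : LL μ θ Z 1 T z * (1 - p (T + 1) * β) / (LL μ θ Z 2 T z * (1 - p (T + 1) * α))
          = LL μ θ Z 1 T z / LL μ θ Z 2 T z * ((1 - p (T + 1) * β) / (1 - p (T + 1) * α)) := by
        rw [mul_div_mul_comm]
      rw [r1] at j1
      have j2 : β * (LL μ θ Z 2 T z * (p (T + 1) * α * Phi α β (a / b) p n (T + 1)
          (LL μ θ Z 1 T z / LL μ θ Z 2 T z / (a / b)))) ≤
          μ.real {ω | (θ ω = 2 ∧ ∀ s ∈ Finset.Icc 1 (T + 1),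
            Z s ω = Function.update z (T + 1) 2 s) ∧ Z (T + 1 + n + 1) ω = 1} := by
        rcases hp.1.eq_or_lt with h | h
        · rw [← h]; simp
        · have := i2 (by positivity)
          have r2 : LL μ θ Z 1 T z * (β * p (T + 1)) / (LL μ θ Z 2 T z * (α * p (T + 1)))
              = LL μ θ Z 1 T z / LL μ θ Z 2 T z / (a / b) := by
            rw [hkαβ]; field_simp
          rw [r2] at this
          linarith
      linarith
    · simp only [Phi, hk, if_false, mul_zero]
      exact measureReal_nonneg

theorem ones_good (hC : IsCascade a b p μ θ X I Z) (hb : 0 < b) (hab : b < a) (T : ℕ) :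
    0 < LL μ θ Z 2 (T + 2) (fun _ => 1) ∧
      a * LL μ θ Z 2 (T + 2) (fun _ => 1) < b * LL μ θ Z 1 (T + 2) (fun _ => 1) := by
  have ha : 0 < a := hb.trans hab
  have hs : 0 < a + b := by linarith
  have hupd : ∀ T, Function.update (fun _ : ℕ => 1) (T + 1) 1 = fun _ => 1 :=
    fun T => Function.update_eq_self (T + 1) (fun _ : ℕ => 1)
  have t2 : signalProb a b 2 1 = b / (a + b) := by simp [signalProb]
  have t1 : signalProb a b 1 1 = a / (a + b) := by simp [signalProb]
  have s2 : signalProb a b 2 2 = a / (a + b) := by simp [signalProb]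
  have s1 : signalProb a b 1 2 = b / (a + b) := by simp [signalProb]
  have L0 : ∀ i, i = 1 ∨ i = 2 → LL μ θ Z i 0 (fun _ => 1) = 1 / 2 := by
    intro i hi
    rw [← half hC hi]
    simp [LL, Measure.real]
  have L01 := L0 1 (Or.inl rfl)
  have L02 := L0 2 (Or.inr rfl)
  have L1 : ∀ i, i = 1 ∨ i = 2 → LL μ θ Z i 1 (fun _ => 1) = 1 / 2 * signalProb a b i 1 := by
    intro i hi
    have := LL_mid_one hC hb hab hi 0 (fun _ => 1) (by rw [L01, L02]; linarith)
      (by rw [L01, L02]; linarith)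
    rw [hupd, L0 i hi] at this
    exact this
  have L11 := L1 1 (Or.inl rfl)
  have L12 := L1 2 (Or.inr rfl)
  have L2 : ∀ i, i = 1 ∨ i = 2 →
      LL μ θ Z i 2 (fun _ => 1) = 1 / 2 * signalProb a b i 1 * signalProb a b i 1 := by
    intro i hi
    have := LL_mid_one hC hb hab hi 1 (fun _ => 1)
      (by rw [L11, L12, t1, t2]; apply le_of_eq; ring)
      (by
        rw [L11, L12, t1, t2, ← mul_div_assoc, ← mul_div_assoc, ← mul_div_assoc, ← mul_div_assoc]
        apply div_le_div_of_nonneg_right _ hs.le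
        nlinarith)
    rw [hupd, L1 i hi] at this
    exact this
  induction T with
  | zero =>
    rw [L2 2 (Or.inr rfl), L2 1 (Or.inl rfl), t1, t2]
    have hα : 0 < a / (a + b) := by positivity
    have hβ : 0 < b / (a + b) := by positivity
    refine ⟨by positivity, ?_⟩
    have e : b * (1 / 2 * (a / (a + b)) * (a / (a + b))) - a * (1 / 2 * (b / (a + b)) * (b / (a + b)))
        = a * b * (a - b) / (2 * (a + b) ^ 2) := by field_simp
    have : 0 < a * b * (a - b) / (2 * (a + b) ^ 2) :=
      div_pos (mul_pos (mul_pos ha hb) (by linarith)) (by positivity)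
    linarith
  | succ T ih =>
    obtain ⟨h0, hg⟩ := ih
    have hp := hC.p_mem (T + 2 + 1) (by omega)
    have a1 := LL_add hC 1 (T + 2) (fun _ => 1)
    have a2 := LL_add hC 2 (T + 2) (fun _ => 1)
    have g1 := LL_good_two hC hb hab (i := 1) (Or.inl rfl) (T + 2) (fun _ => 1) hg
    have g2 := LL_good_two hC hb hab (i := 2) (Or.inr rfl) (T + 2) (fun _ => 1) hg
    rw [s1] at g1
    rw [s2] at g2
    rw [hupd, g1] at a1
    rw [hupd, g2] at a2
    rw [show T + 1 + 2 = T + 2 + 1 by omega]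
    have e1 : LL μ θ Z 1 (T + 2 + 1) (fun _ => 1)
        = LL μ θ Z 1 (T + 2) (fun _ => 1) * (1 - p (T + 2 + 1) * (b / (a + b))) := by linarith
    have e2 : LL μ θ Z 2 (T + 2 + 1) (fun _ => 1)
        = LL μ θ Z 2 (T + 2) (fun _ => 1) * (1 - p (T + 2 + 1) * (a / (a + b))) := by linarith
    have hα1 : a / (a + b) < 1 := by rw [div_lt_one hs]; linarith
    have hα0 : 0 < a / (a + b) := by positivity
    have hβα : b / (a + b) < a / (a + b) := div_lt_div_of_pos_right hab hs
    have q1 : 0 < 1 - p (T + 2 + 1) * (a / (a + b)) := by nlinarith [hp.1, hp.2]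
    have q2 : 1 - p (T + 2 + 1) * (a / (a + b)) ≤ 1 - p (T + 2 + 1) * (b / (a + b)) := by
      nlinarith [hp.1, hp.2]
    rw [e1, e2]
    refine ⟨by positivity, ?_⟩
    have n1 : 0 < LL μ θ Z 1 (T + 2) (fun _ => 1) := by
      have : 0 < b * LL μ θ Z 1 (T + 2) (fun _ => 1) := lt_trans (by positivity) hg
      exact pos_of_mul_pos_right this hb.le
    calc a * (LL μ θ Z 2 (T + 2) (fun _ => 1) * (1 - p (T + 2 + 1) * (a / (a + b))))
        = a * LL μ θ Z 2 (T + 2) (fun _ => 1) * (1 - p (T + 2 + 1) * (a / (a + b))) := by ring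
      _ < b * LL μ θ Z 1 (T + 2) (fun _ => 1) * (1 - p (T + 2 + 1) * (a / (a + b))) :=
          mul_lt_mul_of_pos_right hg q1
      _ ≤ b * LL μ θ Z 1 (T + 2) (fun _ => 1) * (1 - p (T + 2 + 1) * (b / (a + b))) := by gcongr
      _ = _ := by ring

theorem err_reveal (hC : IsCascade a b p μ θ X I Z) (t : ℕ) (ht : 1 ≤ t) :
    b / (a + b) * p t ≤ μ.real {ω | Z t ω ≠ θ ω} := by
  have := hC.prob
  have h1 := hC.joint 1 (Or.inl rfl) {t} (by simpa using ht) (fun _ => 2) (fun _ => 1)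
    (by simp) (by simp)
  have h2 := hC.joint 2 (Or.inr rfl) {t} (by simpa using ht) (fun _ => 1) (fun _ => 1)
    (by simp) (by simp)
  simp only [Finset.mem_singleton, forall_eq, Finset.prod_singleton, if_true, signalProb] at h1 h2
  norm_num at h1 h2
  have hm : MeasurableSet {ω | θ ω = 1} := hC.theta_meas (measurableSet_singleton 1)
  have hsplit := measureReal_inter_add_sdiff (μ := μ) (s := {ω | Z t ω ≠ θ ω}) (ht := hm)
  have l1 : μ.real {ω | θ ω = 1 ∧ X t ω = 2 ∧ I t ω = 1}
      ≤ μ.real ({ω | Z t ω ≠ θ ω} ∩ {ω | θ ω = 1}) := by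
    refine measureReal_mono ?_ (measure_ne_top _ _)
    rintro ω ⟨g1, g2, g3⟩
    refine ⟨?_, g1⟩
    change Z t ω ≠ θ ω
    rw [hC.dynamics t ht, if_pos g3, g1, g2]; norm_num
  have l2 : μ.real {ω | θ ω = 2 ∧ X t ω = 1 ∧ I t ω = 1}
      ≤ μ.real ({ω | Z t ω ≠ θ ω} \ {ω | θ ω = 1}) := by
    refine measureReal_mono ?_ (measure_ne_top _ _)
    rintro ω ⟨g1, g2, g3⟩
    refine ⟨?_, ?_⟩
    · change Z t ω ≠ θ ω
      rw [hC.dynamics t ht, if_pos g3, g1, g2]; norm_num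
    · change ¬ (θ ω = 1)
      rw [g1]; norm_num
  rw [← Measure.real] at h1 h2
  linarith

end Prob

theorem harmonic_le_log (T : ℕ) (hT : 1 ≤ T) (n : ℕ) :
    ∑ j ∈ Finset.Ioc T (T + n), (1 : ℝ) / j ≤ Real.log (T + n : ℕ) - Real.log T := by
  induction n with
  | zero => simp
  | succ n ih =>
    rw [← add_assoc, ← Finset.insert_Ioc_right_eq_Ioc_add_one (by omega),
      Finset.sum_insert (by simp)]
    have hm : (0 : ℝ) < (T + n : ℕ) := by exact_mod_cast (by omega : 0 < T + n)
    have hm1 : (0 : ℝ) < (T + n + 1 : ℕ) := by exact_mod_cast (by omega : 0 < T + n + 1)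
    have h := Real.one_sub_inv_le_log_of_pos (div_pos hm1 hm)
    rw [Real.log_div hm1.ne' hm.ne', inv_div] at h
    have e : (1 : ℝ) / (T + n + 1 : ℕ) = 1 - (T + n : ℕ) / (T + n + 1 : ℕ) := by
      field_simp; push_cast; ring
    linarith

theorem main_aux (a b : ℝ) (hb : 0 < b) (hab : b < a)
    (p : ℕ → ℝ) {Ω : Type*} [MeasurableSpace Ω] (μ : Measure Ω) (θ : Ω → ℕ)
    (X I Z : ℕ → Ω → ℕ) (hC : IsCascade a b p μ θ X I Z) (c : ℝ) (hc0 : 0 < c)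
    (hc : c < kappaStar a b)
    (hev : ∀ᶠ t : ℕ in atTop, (t : ℝ) * μ.real {ω | Z t ω ≠ θ ω} ≤ c) : False := by
  have := hC.prob
  have ha : 0 < a := hb.trans hab
  have hs : 0 < a + b := by linarith
  set α := a / (a + b) with hαd
  set β := b / (a + b) with hβd
  have hα : 0 < α := by positivity
  have hβ : 0 < β := by positivity
  have hα1 : α < 1 := by rw [hαd, div_lt_one hs]; linarith
  have hβα : β < α := div_lt_div_of_pos_right hab hs
  have hkαβ : a / b = α / β := by rw [hαd, hβd]; field_simp
  set D := 1 + (a / b - 1) / Real.log (a / b) *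
      (Real.log ((a / b - 1) / Real.log (a / b)) - 1) with hD
  have hκ : c < 1 / D := hc
  have hDpos : 0 < D := one_div_pos.1 (hc0.trans hκ)
  have hDc : β * D < β / c := by
    rw [lt_div_iff₀ hDpos] at hκ
    rw [lt_div_iff₀ hc0]
    nlinarith
  obtain ⟨γ, hγ1, hγ2⟩ := exists_between hDc
  have hγ0 : 0 < γ := lt_trans (by positivity) hγ1
  obtain ⟨T2, hT2⟩ := eventually_atTop.1 hev
  have hpb : ∀ t, T2 ≤ t → 1 ≤ t → p t ≤ c / β * (1 / t) := by
    intro t h1 h2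
    have g1 := hT2 t h1
    have g2 := err_reveal hC t h2
    have ht : (0 : ℝ) < t := by exact_mod_cast h2
    rw [div_mul_div_comm, mul_one, le_div_iff₀ (by positivity)]
    have := mul_le_mul_of_nonneg_left g2 ht.le
    nlinarith
  have hlim : Tendsto p atTop (nhds 0) := by
    have h0 : Tendsto (fun t : ℕ => c / β * (1 / (t : ℝ))) atTop (nhds 0) := by
      simpa using (tendsto_one_div_atTop_nhds_zero_nat (𝕜 := ℝ)).const_mul (c / β)
    refine tendsto_of_tendsto_of_tendsto_of_le_of_le' tendsto_const_nhds h0 ?_ ?_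
    · filter_upwards [eventually_ge_atTop 1] with t ht using (hC.p_mem t ht).1
    · filter_upwards [eventually_ge_atTop 1, eventually_ge_atTop T2] with t ht ht2
        using hpb t ht2 ht
  obtain ⟨T1, hT1⟩ := Phi_exp hβ hβα hα1 hkαβ hC.p_mem hγ1 hlim
  set T := T1 + T2 + 2 with hT
  obtain ⟨hL2, hgood⟩ := ones_good hC hb hab (T1 + T2)
  rw [← hT] at hL2 hgood
  obtain ⟨C, hC0, hCn⟩ := hT1 T (by omega)
    (LL μ θ Z 1 T (fun _ => 1) / LL μ θ Z 2 T (fun _ => 1)) (by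
      rw [div_lt_div_iff₀ hb hL2]; linarith)
  set C' := β * (LL μ θ Z 2 T (fun _ => 1) * C) with hC'
  have hC'0 : 0 < C' := by positivity
  set q := γ * c / β with hq
  have hq1 : q < 1 := by
    rw [lt_div_iff₀ hc0] at hγ2
    rw [hq, div_lt_one hβ]; exact hγ2
  have key : ∀ n : ℕ, C' * ((T + n + 1 : ℕ) : ℝ) ^ (1 - q) ≤ c := by
    intro n
    have hN : (0 : ℝ) < (T + n + 1 : ℕ) := by positivity
    have h1 := hT2 (T + n + 1) (by omega)
    have h2 := casc hC hb hab n T (fun _ => 1) hL2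
    rw [← hαd, ← hβd] at h2
    have h3 : μ.real {ω | (θ ω = 2 ∧ ∀ s ∈ Finset.Icc 1 T, Z s ω = (fun _ => 1) s) ∧
        Z (T + n + 1) ω = 1} ≤ μ.real {ω | Z (T + n + 1) ω ≠ θ ω} := by
      refine measureReal_mono ?_ (measure_ne_top _ _)
      rintro ω ⟨⟨g1, _⟩, g2⟩
      change Z (T + n + 1) ω ≠ θ ω
      rw [g1, g2]; norm_num
    have hS : ∑ j ∈ Finset.Ioc T (T + n), p j ≤ c / β * Real.log (T + n + 1 : ℕ) := by
      calc ∑ j ∈ Finset.Ioc T (T + n), p j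
          ≤ ∑ j ∈ Finset.Ioc T (T + n), c / β * (1 / (j : ℝ)) := by
            apply Finset.sum_le_sum
            intro j hj
            have := (Finset.mem_Ioc.1 hj).1
            exact hpb j (by omega) (by omega)
        _ = c / β * ∑ j ∈ Finset.Ioc T (T + n), (1 : ℝ) / j := by rw [Finset.mul_sum]
        _ ≤ c / β * Real.log (T + n + 1 : ℕ) := by
            apply mul_le_mul_of_nonneg_left _ (by positivity)
            refine (harmonic_le_log T (by omega) n).trans ?_
            have g1 : 0 ≤ Real.log (T : ℝ) := Real.log_natCast_nonneg T
            have g2 : Real.log (T + n : ℕ) ≤ Real.log (T + n + 1 : ℕ) := by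
              apply Real.log_le_log
              · exact_mod_cast (by omega : 0 < T + n)
              · exact_mod_cast (by omega : T + n ≤ T + n + 1)
            linarith
    have h4 : ((T + n + 1 : ℕ) : ℝ) ^ (-q) ≤
        Real.exp (-γ * ∑ j ∈ Finset.Ioc T (T + n), p j) := by
      rw [Real.rpow_def_of_pos hN]
      apply Real.exp_le_exp.2
      have := mul_le_mul_of_nonneg_left hS hγ0.le
      have e : γ * (c / β * Real.log (T + n + 1 : ℕ)) = Real.log (T + n + 1 : ℕ) * q := by
        rw [hq]; ring
      linarith
    have h5 : C' * ((T + n + 1 : ℕ) : ℝ) ^ (-q) ≤ μ.real {ω | Z (T + n + 1) ω ≠ θ ω} := by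
      refine le_trans ?_ (h2.trans h3)
      rw [hC', mul_assoc, mul_assoc]
      gcongr
      exact le_trans (by gcongr) (hCn n)
    calc C' * ((T + n + 1 : ℕ) : ℝ) ^ (1 - q)
        = ((T + n + 1 : ℕ) : ℝ) * (C' * ((T + n + 1 : ℕ) : ℝ) ^ (-q)) := by
          rw [sub_eq_add_neg, Real.rpow_add hN, Real.rpow_one]; ring
      _ ≤ ((T + n + 1 : ℕ) : ℝ) * μ.real {ω | Z (T + n + 1) ω ≠ θ ω} := by gcongr
      _ ≤ c := h1
  have hinf : Tendsto (fun n : ℕ => C' * ((T + n + 1 : ℕ) : ℝ) ^ (1 - q)) atTop atTop := by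
    apply Tendsto.const_mul_atTop hC'0
    refine (tendsto_rpow_atTop (by linarith)).comp (tendsto_natCast_atTop_atTop.comp ?_)
    exact tendsto_atTop_mono (fun n => by simp only [id]; omega) tendsto_id
  obtain ⟨n, hn⟩ := (hinf.eventually (eventually_gt_atTop c)).exists
  exact absurd (key n) (not_le.2 hn)

/-- For every sequence of revealing probabilities `{p_t} ⊆ [0,1]` (and any
model with these probabilities), `limsup_{t→∞} t·E_t ≥ κ*(a,b)`. -/
theorem learning_rate_lower_bound (a b : ℝ) (hb : 0 < b) (hab : b < a)
    (p : ℕ → ℝ) {Ω : Type*} [MeasurableSpace Ω] (μ : Measure Ω) (θ : Ω → ℕ)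
    (X I Z : ℕ → Ω → ℕ) (hC : IsCascade a b p μ θ X I Z) :
    ENNReal.ofReal (kappaStar a b)
      ≤ Filter.limsup (fun t : ℕ => (t : ℝ≥0∞) * μ {ω | Z t ω ≠ θ ω})
          Filter.atTop := by
  have := hC.prob
  by_contra hlt
  rw [not_le] at hlt
  obtain ⟨c, hc1, hc2⟩ := exists_between hlt
  have hct : c ≠ ∞ := ne_top_of_lt hc2
  have hev := eventually_lt_of_limsup_lt hc1
  have hc0 : 0 < c.toReal := ENNReal.toReal_pos (pos_of_gt hc1).ne' hct
  refine main_aux a b hb hab p μ θ X I Z hC c.toReal hc0 ?_ ?_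
  · exact (ENNReal.lt_ofReal_iff_toReal_lt hct).1 hc2
  · filter_upwards [hev] with t ht
    have := ENNReal.toReal_mono hct ht.le
    rwa [ENNReal.toReal_mul, ENNReal.toReal_natCast] at this
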